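/- For any two policies π and π', any reward r : S×A → ℝ, any discount γ ∈ [0,1), and any state s: V_{π'}(s) = V_π(s) + Σ_{t=0}^∞ γ^t Σ_{s'} (M_{π'}^t)(s,s') Σ_a (π'(a|s') − π(a|s')) A_π(s',a); that is, in the performance-difference identity for V_{π'} − V_π the action-value function Q_π may be replaced by the advantage A_π. -/

import Mathlib

open Finset

variable {S A : Type*} [Fintype S] [Fintype A] [DecidableEq S] [Nonempty S] [Nonempty A]

/-- A transition kernel: nonnegative, rows summing to one. -/
def IsKernel (P : S → A → S → ℝ) : Prop :=
  (∀ s a s', 0 ≤ P s a s') ∧ (∀ s a, ∑ s' : S, P s a s' = 1)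

/-- A (stationary, stochastic) policy. -/
def IsPolicy (π : S → A → ℝ) : Prop :=
  (∀ s a, 0 ≤ π s a) ∧ (∀ s : S, ∑ a : A, π s a = 1)

/-- The Bellman equations for discount `γ` and reward `r`: `(V, Q)` are the value and
action-value functions of `π` iff these hold. -/
def IsValueFun (P : S → A → S → ℝ) (π : S → A → ℝ) (r : S → A → ℝ) (γ : ℝ)
    (V : S → ℝ) (Q : S → A → ℝ) : Prop :=
  (∀ s a, Q s a = r s a + γ * ∑ s' : S, P s a s' * V s') ∧
  (∀ s : S, V s = ∑ a : A, π s a * Q s a)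

/-- The state-transition matrix induced by a policy. -/
noncomputable def Mmat (P : S → A → S → ℝ) (π : S → A → ℝ) : Matrix S S ℝ :=
  Matrix.of fun s s' => ∑ a : A, π s a * P s a s'

theorem Mmat_pow_bound (P : S → A → S → ℝ) (hP : IsKernel P)
    (π : S → A → ℝ) (hπ : IsPolicy π) (f : S → ℝ) (C : ℝ) (hf : ∀ s, |f s| ≤ C) (t : ℕ) :
    ∀ s, |(Matrix.mulVec (Mmat P π ^ t) f) s| ≤ C := by
  induction t with
  | zero => simpa using hf
  | succ t ih =>
    intro s
    rw [pow_succ', ← Matrix.mulVec_mulVec]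
    have hn : ∀ s s', 0 ≤ Mmat P π s s' := fun s s' =>
      Finset.sum_nonneg fun a _ => mul_nonneg (hπ.1 s a) (hP.1 s a s')
    have h1 : ∑ s', Mmat P π s s' = 1 := by
      simp only [Mmat, Matrix.of_apply]
      rw [Finset.sum_comm]
      simp only [← Finset.mul_sum, hP.2, mul_one, hπ.2]
    calc |∑ s', Mmat P π s s' * (Matrix.mulVec (Mmat P π ^ t) f) s'|
        ≤ ∑ s', |Mmat P π s s' * (Matrix.mulVec (Mmat P π ^ t) f) s'| :=
          Finset.abs_sum_le_sum_abs _ _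
      _ ≤ ∑ s', Mmat P π s s' * C := by
          refine Finset.sum_le_sum fun s' _ => ?_
          rw [abs_mul, abs_of_nonneg (hn s s')]
          exact mul_le_mul_of_nonneg_left (ih s') (hn s s')
      _ = C := by rw [← Finset.sum_mul, h1, one_mul]

/-- Performance-difference identity with the advantage `A_π = Q_π − V_π` in place of `Q_π`:
`V_{π'}(s) = V_π(s) + Σ_{t=0}^∞ γ^t Σ_{s'} (M_{π'}^t)(s,s') Σ_a (π'(a|s') − π(a|s')) A_π(s',a)`. -/
theorem performance_difference_advantage
    (P : S → A → S → ℝ) (hP : IsKernel P)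
    (π π' : S → A → ℝ) (hπ : IsPolicy π) (hπ' : IsPolicy π')
    (r : S → A → ℝ) (γ : ℝ) (hγ0 : 0 ≤ γ) (hγ1 : γ < 1)
    (V : S → ℝ) (Q : S → A → ℝ) (hVQ : IsValueFun P π r γ V Q)
    (V' : S → ℝ) (Q' : S → A → ℝ) (hVQ' : IsValueFun P π' r γ V' Q')
    (s : S) :
    V' s = V s + ∑' t : ℕ, γ ^ t * ∑ s' : S, (Mmat P π' ^ t) s s' *
      ∑ a : A, (π' s' a - π s' a) * (Q s' a - V s') := by
  obtain ⟨hQ, hV⟩ := hVQ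
  obtain ⟨hQ', hV'⟩ := hVQ'
  set g : S → ℝ := fun s' => ∑ a : A, (π' s' a - π s' a) * (Q s' a - V s') with hg
  set D : S → ℝ := fun s => V' s - V s with hD
  have hbd : ∀ f : S → ℝ, ∀ s, |f s| ≤ ∑ x, |f x| := fun f s =>
    Finset.single_le_sum (f := fun x => |f x|) (fun i _ => abs_nonneg _) (Finset.mem_univ s)
  have hgM : g = D - γ • Matrix.mulVec (Mmat P π') D := by
    funext x
    have e1 : g x = ∑ a, π' x a * Q x a - V x := by
      simp only [hg, sub_mul, mul_sub, Finset.sum_sub_distrib, ← Finset.sum_mul, hπ.2, hπ'.2,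
        ← hV]
      ring
    have e2 : (Matrix.mulVec (Mmat P π') D) x = ∑ a, π' x a * ∑ s', P x a s' * D s' := by
      simp only [Matrix.mulVec, dotProduct, Mmat, Matrix.of_apply, Finset.sum_mul, Finset.mul_sum]
      rw [Finset.sum_comm]
      simp only [mul_assoc]
    have e3 : ∀ a, Q' x a - Q x a = γ * ∑ s', P x a s' * D s' := by
      intro a
      rw [hQ, hQ']
      simp only [hD, mul_sub, Finset.sum_sub_distrib]
      ring
    simp only [Pi.sub_apply, Pi.smul_apply, smul_eq_mul]
    rw [e1, e2, Finset.mul_sum]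
    have e4 : ∑ a, γ * (π' x a * ∑ s', P x a s' * D s')
        = ∑ a, π' x a * Q' x a - ∑ a, π' x a * Q x a := by
      rw [← Finset.sum_sub_distrib]
      refine Finset.sum_congr rfl fun a _ => ?_
      rw [← mul_sub, e3]; ring
    rw [e4, ← hV']
    simp only [hD]; ring
  have hterm : ∀ t : ℕ, γ ^ t * (Matrix.mulVec (Mmat P π' ^ t) g) s
      = γ ^ t * (Matrix.mulVec (Mmat P π' ^ t) D) s
        - γ ^ (t + 1) * (Matrix.mulVec (Mmat P π' ^ (t + 1)) D) s := by
    intro t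
    rw [hgM, Matrix.mulVec_sub, Matrix.mulVec_smul, Matrix.mulVec_mulVec, ← pow_succ]
    simp only [Pi.sub_apply, Pi.smul_apply, smul_eq_mul]
    ring
  have hb : ∀ f : S → ℝ, ∀ t : ℕ, ‖γ ^ t * (Matrix.mulVec (Mmat P π' ^ t) f) s‖
      ≤ γ ^ t * ∑ x, |f x| := by
    intro f t
    rw [Real.norm_eq_abs, abs_mul, abs_of_nonneg (pow_nonneg hγ0 t)]
    exact mul_le_mul_of_nonneg_left (Mmat_pow_bound P hP π' hπ' f _ (hbd f) t s)
      (pow_nonneg hγ0 t)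
  have hsum : ∀ f : S → ℝ, Summable fun t : ℕ => γ ^ t * (Matrix.mulVec (Mmat P π' ^ t) f) s :=
    fun f => Summable.of_norm_bounded
      ((summable_geometric_of_lt_one hγ0 hγ1).mul_right _) (hb f)
  have key : ∑' t : ℕ, γ ^ t * (Matrix.mulVec (Mmat P π' ^ t) g) s = D s := by
    have hs := hsum D
    simp only [hterm]
    rw [Summable.tsum_sub hs ((summable_nat_add_iff 1).2 hs), hs.tsum_eq_zero_add]
    simp
  have : ∑' t : ℕ, γ ^ t * ∑ s' : S, (Mmat P π' ^ t) s s' * g s' = D s := key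
  rw [this]
  simp only [hD]; ring
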